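/- arXiv:1102.3289 — 3 statements merged into one kernel-verified Lean document; each statement's English description precedes it below -/
import Mathlib

section
/- Let J be a positive integer, Λ and Σ J×J real symmetric positive definite matrices, θ ∈ ℝ^J, and 0 < ε < 1. Let x be a random vector in ℝ^J whose law is the probability measure proportional to the measure [ε·(Gaussian with mean 0, covariance Λ) + (1−ε)·(Dirac at 0)] reweighted by the density x ↦ 𝒩_J(x; θ, Σ). Then the mean of x is E[x] = t(θ; Σ)·φ, where φ = (Λ⁻¹ + Σ⁻¹)⁻¹ Σ⁻¹ θ and t(θ; Σ) = 1 / (1 + ((1−ε)/ε) · (det(Λ+Σ))^{1/2}/(det Σ)^{1/2} · exp(−(1/2) θᵀ (Σ⁻¹ − (Σ+Λ)⁻¹) θ)). -/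
open MeasureTheory Matrix

/-- The multivariate Gaussian density `𝒩_J(x; m, C)` on `ℝ^J`. -/
noncomputable def gaussDensity {J : ℕ} (C : Matrix (Fin J) (Fin J) ℝ) (m x : Fin J → ℝ) : ℝ :=
  (2 * Real.pi) ^ (-(J : ℝ) / 2) * C.det ^ (-(1 : ℝ) / 2) *
    Real.exp (-(1 / 2) * ((x - m) ⬝ᵥ (C⁻¹ *ᵥ (x - m))))

open scoped MatrixOrder in
/-- A positive definite real matrix is a Gram matrix of an invertible square matrix. -/
theorem Matrix.PosDef.exists_transpose_mul_self {ι : Type*} [Fintype ι] [DecidableEq ι]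
    {A : Matrix ι ι ℝ} (hA : A.PosDef) : ∃ B : Matrix ι ι ℝ, Bᵀ * B = A ∧ B.det ≠ 0 := by
  have h0 : (0 : Matrix ι ι ℝ) ≤ A := Matrix.nonneg_iff_posSemidef.2 hA.posSemidef
  have hB : (CFC.sqrt A)ᵀ = CFC.sqrt A := by
    have := (Matrix.nonneg_iff_posSemidef.1 (CFC.sqrt_nonneg A)).isHermitian
    rwa [Matrix.IsHermitian, Matrix.conjTranspose_eq_transpose_of_trivial] at this
  have hmul : (CFC.sqrt A)ᵀ * CFC.sqrt A = A := by rw [hB, CFC.sqrt_mul_sqrt_self A h0]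
  refine ⟨CFC.sqrt A, hmul, fun h => hA.det_pos.ne' ?_⟩
  rw [← hmul, Matrix.det_mul, h, mul_zero]

theorem exp_neg_half_dotProduct_self {ι : Type*} [Fintype ι] (z : ι → ℝ) :
    Real.exp (-(1 / 2) * (z ⬝ᵥ z)) = ∏ i, Real.exp (-(1 / 2) * z i ^ 2) := by
  rw [← Real.exp_sum, dotProduct, Finset.mul_sum]
  simp only [sq]

theorem integrable_exp_neg_half_dotProduct_self {ι : Type*} [Fintype ι] :
    Integrable fun z : ι → ℝ => Real.exp (-(1 / 2) * (z ⬝ᵥ z)) := by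
  simp only [exp_neg_half_dotProduct_self]
  exact Integrable.fintype_prod (f := fun _ (v : ℝ) => Real.exp (-(1 / 2) * v ^ 2))
    fun _ => integrable_exp_neg_mul_sq (by norm_num)

theorem integral_exp_neg_half_dotProduct_self {ι : Type*} [Fintype ι] :
    ∫ z : ι → ℝ, Real.exp (-(1 / 2) * (z ⬝ᵥ z)) =
      (2 * Real.pi) ^ ((Fintype.card ι : ℝ) / 2) := by
  simp only [exp_neg_half_dotProduct_self]
  rw [integral_fintype_prod_volume_eq_pow (fun v : ℝ => Real.exp (-(1 / 2) * v ^ 2)),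
    integral_gaussian, Real.sqrt_eq_rpow, ← Real.rpow_natCast, ← Real.rpow_mul (by positivity)]
  congr 1 <;> ring

theorem integrable_exp_neg_half_dotProduct_self_smul {ι : Type*} [Fintype ι] :
    Integrable fun z : ι → ℝ => Real.exp (-(1 / 2) * (z ⬝ᵥ z)) • z := by
  classical
  refine Integrable.of_eval fun i => ?_
  have h : ∀ j, Integrable (fun v : ℝ =>
      if j = i then v * Real.exp (-(1 / 2) * v ^ 2) else Real.exp (-(1 / 2) * v ^ 2)) := by
    intro j
    split_ifs
    · exact integrable_mul_exp_neg_mul_sq (by norm_num)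
    · exact integrable_exp_neg_mul_sq (by norm_num)
  refine (Integrable.fintype_prod h).congr (Filter.Eventually.of_forall fun z => ?_)
  simp only [Pi.smul_apply, smul_eq_mul, exp_neg_half_dotProduct_self]
  have : ∀ j, (if j = i then z j * Real.exp (-(1 / 2) * z j ^ 2)
      else Real.exp (-(1 / 2) * z j ^ 2)) =
      Real.exp (-(1 / 2) * z j ^ 2) * (if j = i then z j else 1) := by
    intro j
    split_ifs <;> ring
  simp only [this, Finset.prod_mul_distrib]
  simp

theorem dotProduct_transpose_mul_self_mulVec {ι : Type*} [Fintype ι]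
    (B : Matrix ι ι ℝ) (y : ι → ℝ) :
    y ⬝ᵥ ((Bᵀ * B) *ᵥ y) = (B *ᵥ y) ⬝ᵥ (B *ᵥ y) := by
  rw [← mulVec_mulVec, dotProduct_mulVec, vecMul_transpose]

theorem MeasureTheory.Integrable.comp_mulVec {ι E : Type*} [Fintype ι] [DecidableEq ι]
    [NormedAddCommGroup E] {B : Matrix ι ι ℝ} (hB : B.det ≠ 0) {f : (ι → ℝ) → E}
    (hf : Integrable f) : Integrable fun y => f (B *ᵥ y) := by
  have h : Integrable f (Measure.map (toLin' B) volume) := by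
    rw [Real.map_matrix_volume_pi_eq_smul_volume_pi hB]
    exact hf.smul_measure ENNReal.ofReal_ne_top
  exact h.comp_measurable (LinearMap.continuous_of_finiteDimensional _).measurable

theorem integral_comp_mulVec {ι E : Type*} [Fintype ι] [DecidableEq ι]
    [NormedAddCommGroup E] [NormedSpace ℝ E] {B : Matrix ι ι ℝ} (hB : B.det ≠ 0)
    {f : (ι → ℝ) → E} (hf : Integrable f) :
    ∫ y, f (B *ᵥ y) = |B.det|⁻¹ • ∫ z, f z := by
  have h : AEStronglyMeasurable f (Measure.map (toLin' B) volume) := by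
    rw [Real.map_matrix_volume_pi_eq_smul_volume_pi hB]
    exact (hf.smul_measure ENNReal.ofReal_ne_top).aestronglyMeasurable
  have key := integral_map
    (LinearMap.continuous_of_finiteDimensional (toLin' B)).measurable.aemeasurable h
  rw [Real.map_matrix_volume_pi_eq_smul_volume_pi hB, integral_smul_measure,
    ENNReal.toReal_ofReal (abs_nonneg _), abs_inv] at key
  simpa using key.symm

section GaussianIntegrals

variable {ι : Type*} [Fintype ι] [DecidableEq ι] {A : Matrix ι ι ℝ}

theorem Matrix.PosDef.integrable_exp_neg_half (hA : A.PosDef) :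
    Integrable fun y : ι → ℝ => Real.exp (-(1 / 2) * (y ⬝ᵥ (A *ᵥ y))) := by
  obtain ⟨B, rfl, hB⟩ := hA.exists_transpose_mul_self
  simp only [dotProduct_transpose_mul_self_mulVec]
  exact integrable_exp_neg_half_dotProduct_self.comp_mulVec hB

theorem Matrix.PosDef.integral_exp_neg_half (hA : A.PosDef) :
    ∫ y : ι → ℝ, Real.exp (-(1 / 2) * (y ⬝ᵥ (A *ᵥ y))) =
      (2 * Real.pi) ^ ((Fintype.card ι : ℝ) / 2) * A.det ^ (-(1 : ℝ) / 2) := by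
  obtain ⟨B, rfl, hB⟩ := hA.exists_transpose_mul_self
  simp only [dotProduct_transpose_mul_self_mulVec]
  rw [integral_comp_mulVec hB integrable_exp_neg_half_dotProduct_self,
    integral_exp_neg_half_dotProduct_self, det_mul, det_transpose, ← abs_mul_abs_self,
    smul_eq_mul, mul_comm, ← sq, ← Real.rpow_natCast, ← Real.rpow_mul (abs_nonneg _),
    ← Real.rpow_neg_one]
  norm_num

theorem Matrix.PosDef.integrable_exp_neg_half_smul (hA : A.PosDef) :
    Integrable fun y : ι → ℝ => Real.exp (-(1 / 2) * (y ⬝ᵥ (A *ᵥ y))) • y := by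
  obtain ⟨B, rfl, hB⟩ := hA.exists_transpose_mul_self
  have h := (integrable_exp_neg_half_dotProduct_self_smul (ι := ι)).comp_mulVec hB
  refine ((toLin' B⁻¹).toContinuousLinearMap.integrable_comp h).congr
    (Filter.Eventually.of_forall fun y => ?_)
  simp only [dotProduct_transpose_mul_self_mulVec]
  simp [mulVec_mulVec, nonsing_inv_mul B (isUnit_iff_ne_zero.2 hB)]

end GaussianIntegrals

theorem integral_exp_neg_half_smul_eq_zero {ι : Type*} [Fintype ι] (A : Matrix ι ι ℝ) :
    ∫ y : ι → ℝ, Real.exp (-(1 / 2) * (y ⬝ᵥ (A *ᵥ y))) • y = 0 := by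
  have h := integral_neg_eq_self
    (fun y : ι → ℝ => Real.exp (-(1 / 2) * (y ⬝ᵥ (A *ᵥ y))) • y) volume
  simp only [mulVec_neg, neg_dotProduct_neg, smul_neg, integral_neg] at h
  exact self_eq_neg.1 h.symm

section GaussDensity

variable {J : ℕ} {C : Matrix (Fin J) (Fin J) ℝ}

theorem gaussDensity_pos (hC : C.PosDef) (m x : Fin J → ℝ) : 0 < gaussDensity C m x := by
  have := hC.det_pos
  unfold gaussDensity
  positivity

theorem continuous_gaussDensity (C : Matrix (Fin J) (Fin J) ℝ) (m : Fin J → ℝ) :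
    Continuous (gaussDensity C m) := by
  unfold gaussDensity
  fun_prop

theorem integrable_gaussDensity (hC : C.PosDef) (m : Fin J → ℝ) :
    Integrable (gaussDensity C m) := by
  unfold gaussDensity
  exact (hC.inv.integrable_exp_neg_half.comp_sub_right m).const_mul _

theorem integral_gaussDensity (hC : C.PosDef) (m : Fin J → ℝ) :
    ∫ x, gaussDensity C m x = 1 := by
  unfold gaussDensity
  have hd := hC.det_pos
  rw [integral_const_mul, integral_sub_right_eq_self
    (fun y : Fin J → ℝ => Real.exp (-(1 / 2) * (y ⬝ᵥ (C⁻¹ *ᵥ y)))) m,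
    hC.inv.integral_exp_neg_half, det_nonsing_inv, Ring.inverse_eq_inv', Fintype.card_fin,
    neg_div, neg_div, Real.inv_rpow hd.le, Real.rpow_neg hd.le, Real.rpow_neg (by positivity)]
  have h1 : (2 * Real.pi) ^ ((J : ℝ) / 2) ≠ 0 := by positivity
  have h2 : C.det ^ ((1 : ℝ) / 2) ≠ 0 := by positivity
  field_simp

theorem gaussDensity_zero_smul_eq (C : Matrix (Fin J) (Fin J) ℝ) (y : Fin J → ℝ) :
    gaussDensity C 0 y • y = ((2 * Real.pi) ^ (-(J : ℝ) / 2) * C.det ^ (-(1 : ℝ) / 2)) •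
      Real.exp (-(1 / 2) * (y ⬝ᵥ (C⁻¹ *ᵥ y))) • y := by
  rw [gaussDensity, sub_zero, mul_smul]

theorem gaussDensity_smul_eq (C : Matrix (Fin J) (Fin J) ℝ) (m x : Fin J → ℝ) :
    gaussDensity C m x • x =
      gaussDensity C 0 (x - m) • (x - m) + gaussDensity C m x • m := by
  have : gaussDensity C 0 (x - m) = gaussDensity C m x := by simp [gaussDensity]
  rw [this, ← smul_add, sub_add_cancel]

theorem integrable_gaussDensity_zero_smul (hC : C.PosDef) :
    Integrable fun y : Fin J → ℝ => gaussDensity C 0 y • y := by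
  simp only [gaussDensity_zero_smul_eq]
  exact hC.inv.integrable_exp_neg_half_smul.smul
    ((2 * Real.pi) ^ (-(J : ℝ) / 2) * C.det ^ (-(1 : ℝ) / 2))

theorem integrable_gaussDensity_smul (hC : C.PosDef) (m : Fin J → ℝ) :
    Integrable fun x : Fin J → ℝ => gaussDensity C m x • x := by
  simp only [gaussDensity_smul_eq C m]
  exact ((integrable_gaussDensity_zero_smul hC).comp_sub_right m).add
    ((integrable_gaussDensity hC m).smul_const m)

theorem integral_gaussDensity_smul (hC : C.PosDef) (m : Fin J → ℝ) :
    ∫ x : Fin J → ℝ, gaussDensity C m x • x = m := by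
  simp only [gaussDensity_smul_eq C m]
  rw [integral_add ((integrable_gaussDensity_zero_smul hC).comp_sub_right m)
    ((integrable_gaussDensity hC m).smul_const m), integral_smul_const,
    integral_gaussDensity hC, one_smul,
    integral_sub_right_eq_self (fun y : Fin J → ℝ => gaussDensity C 0 y • y) m]
  simp only [gaussDensity_zero_smul_eq]
  rw [integral_smul, integral_exp_neg_half_smul_eq_zero, smul_zero, zero_add]

end GaussDensity

section Product

variable {J : ℕ} {L S : Matrix (Fin J) (Fin J) ℝ}

theorem inv_add_inv_eq (hL : IsUnit L.det) (hS : IsUnit S.det) :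
    L⁻¹ + S⁻¹ = L⁻¹ * (L + S) * S⁻¹ := by
  rw [Matrix.mul_add, Matrix.add_mul, nonsing_inv_mul _ hL, Matrix.one_mul, Matrix.mul_assoc,
    mul_nonsing_inv _ hS, Matrix.mul_one, add_comm]

theorem inv_mul_inv_add_inv_inv_mul_inv (hL : IsUnit L.det) (hS : IsUnit S.det)
    (hLS : IsUnit (L + S).det) :
    S⁻¹ * (L⁻¹ + S⁻¹)⁻¹ * S⁻¹ = S⁻¹ - (L + S)⁻¹ := by
  rw [inv_add_inv_eq hL hS, Matrix.mul_inv_rev, Matrix.mul_inv_rev,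
    nonsing_inv_nonsing_inv _ hL, nonsing_inv_nonsing_inv _ hS, ← Matrix.mul_assoc,
    nonsing_inv_mul _ hS, Matrix.one_mul]
  have h : (L + S)⁻¹ * L = 1 - (L + S)⁻¹ * S := by
    rw [eq_sub_iff_add_eq, ← Matrix.mul_add, nonsing_inv_mul _ hLS]
  rw [h, Matrix.sub_mul, Matrix.one_mul, Matrix.mul_assoc, mul_nonsing_inv _ hS, Matrix.mul_one]

theorem dotProduct_mulVec_comm_of_isSymm {ι : Type*} [Fintype ι] {A : Matrix ι ι ℝ}
    (hA : Aᵀ = A) (x y : ι → ℝ) : x ⬝ᵥ (A *ᵥ y) = y ⬝ᵥ (A *ᵥ x) := by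
  rw [dotProduct_mulVec, ← mulVec_transpose, hA, dotProduct_comm]

theorem Matrix.PosDef.transpose_eq {ι : Type*} [Fintype ι] {A : Matrix ι ι ℝ} (hA : A.PosDef) :
    Aᵀ = A := by
  have := hA.isHermitian
  rwa [Matrix.IsHermitian, conjTranspose_eq_transpose_of_trivial] at this

/-- Completing the square in the product of two Gaussian exponents. -/
theorem complete_square (hL : L.PosDef) (hS : S.PosDef) (θ x φ : Fin J → ℝ)
    (hφ : φ = (L⁻¹ + S⁻¹)⁻¹ *ᵥ (S⁻¹ *ᵥ θ)) :
    x ⬝ᵥ (L⁻¹ *ᵥ x) + (x - θ) ⬝ᵥ (S⁻¹ *ᵥ (x - θ)) =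
      (x - φ) ⬝ᵥ ((L⁻¹ + S⁻¹) *ᵥ (x - φ)) + θ ⬝ᵥ ((L + S)⁻¹ *ᵥ θ) := by
  have hP := hL.inv.add hS.inv
  have hPφ : (L⁻¹ + S⁻¹) *ᵥ φ = S⁻¹ *ᵥ θ := by
    rw [hφ, mulVec_mulVec, mul_nonsing_inv _ hP.det_pos.ne'.isUnit, one_mulVec]
  have hconst : φ ⬝ᵥ (S⁻¹ *ᵥ θ) = θ ⬝ᵥ (S⁻¹ *ᵥ θ) - θ ⬝ᵥ ((L + S)⁻¹ *ᵥ θ) := by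
    rw [dotProduct_mulVec_comm_of_isSymm hS.inv.transpose_eq, hφ, mulVec_mulVec, mulVec_mulVec,
      inv_mul_inv_add_inv_inv_mul_inv hL.det_pos.ne'.isUnit hS.det_pos.ne'.isUnit
        (hL.add hS).det_pos.ne'.isUnit, sub_mulVec, dotProduct_sub]
  have h1 := dotProduct_mulVec_comm_of_isSymm hP.transpose_eq φ x
  have h2 := dotProduct_mulVec_comm_of_isSymm hS.inv.transpose_eq θ x
  simp only [mulVec_sub, sub_dotProduct, dotProduct_sub]
  rw [h1, hPφ, hconst, h2, add_mulVec, dotProduct_add]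
  ring

theorem gaussDensity_zero_mul_gaussDensity (hL : L.PosDef) (hS : S.PosDef)
    (θ x φ : Fin J → ℝ) (hφ : φ = (L⁻¹ + S⁻¹)⁻¹ *ᵥ (S⁻¹ *ᵥ θ)) :
    gaussDensity L 0 x * gaussDensity S θ x =
      gaussDensity (L + S) 0 θ * gaussDensity (L⁻¹ + S⁻¹)⁻¹ φ x := by
  have hP := hL.inv.add hS.inv
  have hLS := hL.add hS
  have hdet : L.det * S.det = (L + S).det * ((L⁻¹ + S⁻¹)⁻¹).det := by
    have h1 := hL.det_pos.ne'
    have h2 := hS.det_pos.ne'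
    have h3 := hLS.det_pos.ne'
    rw [det_nonsing_inv, inv_add_inv_eq h1.isUnit h2.isUnit, det_mul, det_mul, det_nonsing_inv,
      det_nonsing_inv]
    simp only [Ring.inverse_eq_inv']
    field_simp
  have hdet' : L.det ^ (-(1 : ℝ) / 2) * S.det ^ (-(1 : ℝ) / 2) =
      (L + S).det ^ (-(1 : ℝ) / 2) * ((L⁻¹ + S⁻¹)⁻¹).det ^ (-(1 : ℝ) / 2) := by
    rw [← Real.mul_rpow hL.det_pos.le hS.det_pos.le, hdet,
      Real.mul_rpow hLS.det_pos.le hP.inv.det_pos.le]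
  have hexp : Real.exp (-(1 / 2) * (x ⬝ᵥ (L⁻¹ *ᵥ x))) *
      Real.exp (-(1 / 2) * ((x - θ) ⬝ᵥ (S⁻¹ *ᵥ (x - θ)))) =
      Real.exp (-(1 / 2) * (θ ⬝ᵥ ((L + S)⁻¹ *ᵥ θ))) *
        Real.exp (-(1 / 2) * ((x - φ) ⬝ᵥ ((L⁻¹ + S⁻¹) *ᵥ (x - φ)))) := by
    rw [← Real.exp_add, ← Real.exp_add, ← mul_add, ← mul_add, complete_square hL hS θ x φ hφ,
      add_comm]
  unfold gaussDensity
  rw [nonsing_inv_nonsing_inv _ hP.det_pos.ne'.isUnit]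
  simp only [sub_zero]
  set c := (2 * Real.pi) ^ (-(J : ℝ) / 2)
  calc _ = c * c * (L.det ^ (-(1 : ℝ) / 2) * S.det ^ (-(1 : ℝ) / 2)) *
        (Real.exp (-(1 / 2) * (x ⬝ᵥ (L⁻¹ *ᵥ x))) *
          Real.exp (-(1 / 2) * ((x - θ) ⬝ᵥ (S⁻¹ *ᵥ (x - θ))))) := by ring
    _ = _ := by
      rw [hdet', hexp]
      ring

theorem gaussDensity_div_gaussDensity (hL : L.PosDef) (hS : S.PosDef) (θ : Fin J → ℝ) :
    gaussDensity S θ 0 / gaussDensity (L + S) 0 θ =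
      (L + S).det ^ ((1 : ℝ) / 2) / S.det ^ ((1 : ℝ) / 2) *
        Real.exp (-(1 / 2) * (θ ⬝ᵥ ((S⁻¹ - (S + L)⁻¹) *ᵥ θ))) := by
  have h1 := hS.det_pos
  have h2 := (hL.add hS).det_pos
  have hexp : Real.exp (-(1 / 2) * (θ ⬝ᵥ ((S⁻¹ - (S + L)⁻¹) *ᵥ θ))) =
      Real.exp (-(1 / 2) * (θ ⬝ᵥ (S⁻¹ *ᵥ θ))) /
        Real.exp (-(1 / 2) * (θ ⬝ᵥ ((L + S)⁻¹ *ᵥ θ))) := by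
    rw [← Real.exp_sub, add_comm S L, sub_mulVec, dotProduct_sub, mul_sub]
  rw [hexp]
  unfold gaussDensity
  simp only [zero_sub, sub_zero, mulVec_neg, neg_dotProduct_neg]
  rw [neg_div 2 (1 : ℝ), Real.rpow_neg h1.le, Real.rpow_neg h2.le]
  have h3 : (2 * Real.pi) ^ (-(J : ℝ) / 2) ≠ 0 := by positivity
  have h4 : S.det ^ ((1 : ℝ) / 2) ≠ 0 := by positivity
  have h5 : (L + S).det ^ ((1 : ℝ) / 2) ≠ 0 := by positivity
  field_simp

end Product

/-- The mean of the normalization of `a • γ + b • δ₀` for a probability measure `γ`. -/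
theorem integral_id_normalize_smul_add_smul_dirac {E : Type*} [NormedAddCommGroup E]
    [NormedSpace ℝ E] [CompleteSpace E] [MeasurableSpace E] [BorelSpace E]
    {γ : Measure E} [IsProbabilityMeasure γ] (hγ : Integrable (fun x => x) γ)
    {a b : ℝ} (ha : 0 < a) (hb : 0 ≤ b) (μ₀ : Measure E)
    (hμ₀ : μ₀ = ENNReal.ofReal a • γ + ENNReal.ofReal b • Measure.dirac 0) :
    ∫ x, x ∂((μ₀ Set.univ)⁻¹ • μ₀) = (a / (a + b)) • ∫ x, x ∂γ := by
  have huniv : μ₀ Set.univ = ENNReal.ofReal (a + b) := by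
    rw [hμ₀, ENNReal.ofReal_add ha.le hb]
    simp
  have hint0 : Integrable (fun x : E => x) (Measure.dirac 0) :=
    integrable_dirac (by simp)
  rw [integral_smul_measure, huniv, hμ₀, integral_add_measure
    (hγ.smul_measure ENNReal.ofReal_ne_top) (hint0.smul_measure ENNReal.ofReal_ne_top),
    integral_smul_measure, integral_smul_measure, integral_dirac, smul_zero, add_zero, smul_smul,
    ENNReal.toReal_inv, ENNReal.toReal_ofReal (by positivity), ENNReal.toReal_ofReal ha.le,
    inv_mul_eq_div]

theorem stmt1 (J : ℕ) (hJ : 0 < J) (Λ Sig : Matrix (Fin J) (Fin J) ℝ)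
    (hΛ : Λ.PosDef) (hSig : Sig.PosDef) (θ : Fin J → ℝ) (ε : ℝ) (hε0 : 0 < ε) (hε1 : ε < 1)
    (μ₀ : Measure (Fin J → ℝ))
    (hμ₀ : μ₀ = (ENNReal.ofReal ε •
          volume.withDensity (fun x => ENNReal.ofReal (gaussDensity Λ 0 x))
        + ENNReal.ofReal (1 - ε) • Measure.dirac 0).withDensity
          (fun x => ENNReal.ofReal (gaussDensity Sig θ x)))
    -- the law of `x`: the probability measure proportional to `μ₀`
    (μ : Measure (Fin J → ℝ)) (hμ : μ = (μ₀ Set.univ)⁻¹ • μ₀)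
    (φ : Fin J → ℝ) (hφ : φ = (Λ⁻¹ + Sig⁻¹)⁻¹ *ᵥ (Sig⁻¹ *ᵥ θ))
    (t : ℝ) (ht : t = 1 / (1 + (1 - ε) / ε * ((Λ + Sig).det ^ ((1 : ℝ) / 2) / Sig.det ^ ((1 : ℝ) / 2)) *
      Real.exp (-(1 / 2) * (θ ⬝ᵥ ((Sig⁻¹ - (Sig + Λ)⁻¹) *ᵥ θ))))) :
    (∫ x, x ∂μ) = t • φ := by
  have hP := (hΛ.inv.add hSig.inv).inv
  set P := (Λ⁻¹ + Sig⁻¹)⁻¹ with hPdef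
  set γ : Measure (Fin J → ℝ) :=
    volume.withDensity fun x => ENNReal.ofReal (gaussDensity P φ x) with hγ
  have hmeas : ∀ (C : Matrix (Fin J) (Fin J) ℝ) (m : Fin J → ℝ),
      Measurable fun x => ENNReal.ofReal (gaussDensity C m x) := fun C m =>
    (continuous_gaussDensity C m).measurable.ennreal_ofReal
  have hprob : IsProbabilityMeasure γ := by
    constructor
    rw [hγ, withDensity_apply _ MeasurableSet.univ, Measure.restrict_univ,
      ← ofReal_integral_eq_lintegral_ofReal (integrable_gaussDensity hP φ)
        (Filter.Eventually.of_forall fun x => (gaussDensity_pos hP φ x).le),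
      integral_gaussDensity hP, ENNReal.ofReal_one]
  have hlt : ∀ᵐ x : Fin J → ℝ, ENNReal.ofReal (gaussDensity P φ x) < ⊤ :=
    Filter.Eventually.of_forall fun _ => ENNReal.ofReal_lt_top
  have hintegrable : Integrable (fun x => x) γ := by
    rw [hγ, integrable_withDensity_iff_integrable_smul' (hmeas P φ) hlt]
    simp only [ENNReal.toReal_ofReal (gaussDensity_pos hP φ _).le]
    exact integrable_gaussDensity_smul hP φ
  have hmean : ∫ x, x ∂γ = φ := by
    rw [hγ, integral_withDensity_eq_integral_toReal_smul (hmeas P φ) hlt]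
    simp only [ENNReal.toReal_ofReal (gaussDensity_pos hP φ _).le]
    exact integral_gaussDensity_smul hP φ
  have hN₁ := gaussDensity_pos (hΛ.add hSig) 0 θ
  have hN₂ := gaussDensity_pos hSig θ 0
  have hprod : (volume.withDensity fun x => ENNReal.ofReal (gaussDensity Λ 0 x)).withDensity
      (fun x => ENNReal.ofReal (gaussDensity Sig θ x)) =
      ENNReal.ofReal (gaussDensity (Λ + Sig) 0 θ) • γ := by
    rw [← withDensity_mul _ (hmeas Λ 0) (hmeas Sig θ), hγ, ← withDensity_smul _ (hmeas P φ)]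
    congr 1
    funext x
    simp only [Pi.mul_apply, Pi.smul_apply, smul_eq_mul]
    rw [← ENNReal.ofReal_mul (gaussDensity_pos hΛ 0 x).le, ← ENNReal.ofReal_mul hN₁.le,
      gaussDensity_zero_mul_gaussDensity hΛ hSig θ x φ hφ]
  have hmix : μ₀ = ENNReal.ofReal (ε * gaussDensity (Λ + Sig) 0 θ) • γ +
      ENNReal.ofReal ((1 - ε) * gaussDensity Sig θ 0) • Measure.dirac 0 := by
    rw [hμ₀, withDensity_add_measure, withDensity_smul_measure, withDensity_smul_measure, hprod,
      dirac_withDensity, smul_smul, smul_smul, ← ENNReal.ofReal_mul hε0.le,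
      ← ENNReal.ofReal_mul (sub_nonneg.2 hε1.le)]
  have hε1' : 0 < 1 - ε := sub_pos.2 hε1
  rw [hμ, integral_id_normalize_smul_add_smul_dirac hintegrable (by positivity) (by positivity)
    μ₀ hmix, hmean, ht, mul_assoc, ← gaussDensity_div_gaussDensity hΛ hSig]
  congr 1
  field_simp
end

section
/- Let ε, δ > 0 with ε > δ, and let c : ℕ → ℝ satisfy c(0) > 0 and the noiseless state-evolution recursion c(i+1) = (ε/δ) · c(i)/(1 + c(i)) for all i. Then c(i) does not converge to 0; in fact c(i) ≥ min(c(0), ε/δ − 1) > 0 for all i. -/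
theorem stmt6 (ε δ : ℝ) (hε : 0 < ε) (hδ : 0 < δ) (hεδ : δ < ε)
    (c : ℕ → ℝ) (hc0 : 0 < c 0)
    (hrec : ∀ i, c (i + 1) = ε / δ * (c i / (1 + c i))) :
    0 < min (c 0) (ε / δ - 1) ∧ (∀ i, min (c 0) (ε / δ - 1) ≤ c i) ∧
      ¬ Filter.Tendsto c Filter.atTop (nhds 0) := by
  have hr : 0 < ε / δ - 1 := sub_pos.mpr ((one_lt_div hδ).mpr hεδ)
  have hm : 0 < min (c 0) (ε / δ - 1) := lt_min hc0 hr
  have hle : ∀ i, min (c 0) (ε / δ - 1) ≤ c i := by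
    intro i
    induction i with
    | zero => exact min_le_left _ _
    | succ i ih =>
      have hci : 0 < c i := hm.trans_le ih
      rw [hrec, ← mul_div_assoc, le_div_iff₀ (by linarith)]
      have := mul_le_mul_of_nonneg_right (min_le_right (c 0) (ε / δ - 1)) hci.le
      linarith
  exact ⟨hm, hle, fun h => hm.not_ge (ge_of_tendsto' h hle)⟩
end

section
/- Let c > 0, 0 < ε < 1, and r ≥ 0, and for each positive integer J define the shrinkage weight t_J = 1 / (1 + ((1−ε)/ε) · (1 + 1/c)^{J/2} · exp(−J·r/(2c(1+c)))). Set r* = c(1+c)·log(1 + 1/c). Then as J → ∞: (i) if r > r*, then t_J → 1; (ii) if r = r*, then t_J = ε for all J; (iii) if r < r*, then t_J → 0. Thus the shrinkage operator exhibits hard-thresholding behaviour with threshold r* as the number of snapshots J grows. -/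
theorem stmt10 (c ε r : ℝ) (hc : 0 < c) (hε0 : 0 < ε) (hε1 : ε < 1) (hr : 0 ≤ r)
    (t : ℕ → ℝ)
    (ht : ∀ J : ℕ, t J = 1 / (1 + (1 - ε) / ε * (1 + 1 / c) ^ ((J : ℝ) / 2) *
      Real.exp (-(J : ℝ) * r / (2 * c * (1 + c)))))
    (rstar : ℝ) (hrstar : rstar = c * (1 + c) * Real.log (1 + 1 / c)) :
    (rstar < r → Filter.Tendsto t Filter.atTop (nhds 1)) ∧
    (r = rstar → ∀ J : ℕ, 0 < J → t J = ε) ∧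
    (r < rstar → Filter.Tendsto t Filter.atTop (nhds 0)) := by
  have hden : 0 < 2 * c * (1 + c) := by positivity
  have hratio : 0 < (1 - ε) / ε := div_pos (by linarith) hε0
  have hbase : 0 < 1 + 1 / c := by positivity
  have key : ∀ J : ℕ, t J = 1 / (1 + (1 - ε) / ε *
      Real.exp ((J : ℝ) * ((rstar - r) / (2 * c * (1 + c))))) := by
    intro J
    rw [ht, Real.rpow_def_of_pos hbase, mul_assoc, ← Real.exp_add, hrstar]
    congr 4
    field_simp
    ring
  have hlin : Filter.Tendsto (fun J : ℕ => (J : ℝ)) Filter.atTop Filter.atTop :=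
    tendsto_natCast_atTop_atTop
  rw [funext key]
  refine ⟨fun h => ?_, fun h J _ => ?_, fun h => ?_⟩
  · have hexp := Real.tendsto_exp_atBot.comp
      (hlin.atTop_mul_const_of_neg (div_neg_of_neg_of_pos (sub_neg.2 h) hden))
    simpa using ((hexp.const_mul ((1 - ε) / ε)).const_add 1).inv₀ (by simp)
  · rw [h]
    simp only [sub_self, zero_div, mul_zero, Real.exp_zero, mul_one]
    field_simp
    ring
  · have hexp := Real.tendsto_exp_atTop.comp
      (hlin.atTop_mul_const (div_pos (sub_pos.2 h) hden))
    simpa [Pi.inv_def] using (Filter.tendsto_atTop_add_const_left _ 1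
      (hexp.const_mul_atTop hratio)).inv_tendsto_atTop
end
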